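/- Fix integers d \ge 1 and r \ge 1 and a symmetric bilinear form B on \mathbb{R}^d. Let f : (\mathbb{R}^d)^r \to \mathbb{R} be a function which is continuous at every point of (\mathbb{R}^d)^r \setminus \{0\}, vanishes outside \Omega, is homogeneous of degree 0 on \Omega (i.e. f(t v) = f(v) for all t > 0 and v \in \Omega), and is such that the closure of \{v \in \Omega_1 : f(v) \ne 0\} is a compact subset of \Omega_1. Then, as the integer n tends to infinity, n^{-d/2} \sum_{v \in (\mathbb{Z}^d)^r,\; v \in \Omega,\; h(v) \le n} f(v) \;\longrightarrow\; \int_{\Omega_{\le 1}} f\, d\lambda, where \lambda is the Lebesgue measure on (\mathbb{R}^d)^r \cong \mathbb{R}^{dr} for which the lattice (\mathbb{Z}^d)^r has covolume 1. -/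

import Mathlib

open MeasureTheory Filter Topology

/-- cast of integer tuples -/
def castV {r d : ℕ} (m : Fin r → Fin d → ℤ) : Fin r → Fin d → ℝ := fun i j => (m i j : ℝ)

/-- coordinatewise floor -/
noncomputable def floorV {r d : ℕ} (v : Fin r → Fin d → ℝ) : Fin r → Fin d → ℤ := fun i j => ⌊v i j⌋

lemma measurable_floorV {r d : ℕ} : Measurable (floorV : (Fin r → Fin d → ℝ) → _) := by
  refine measurable_pi_lambda _ fun i => measurable_pi_lambda _ fun j => ?_
  exact Int.measurable_floor.comp ((measurable_pi_apply j).comp (measurable_pi_apply i))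

lemma volume_cube {r d : ℕ} (m : Fin r → Fin d → ℤ) :
    volume (floorV ⁻¹' {m} : Set (Fin r → Fin d → ℝ)) = 1 := by
  have : (floorV ⁻¹' {m} : Set (Fin r → Fin d → ℝ)) =
      Set.univ.pi fun i => Set.univ.pi fun j => Set.Ico (m i j : ℝ) (m i j + 1) := by
    ext v
    simp [floorV, funext_iff, Int.floor_eq_iff]
  rw [this, volume_pi_pi]
  simp [volume_pi_pi]

lemma integral_floor {r d : ℕ} (g : (Fin r → Fin d → ℤ) → ℝ) (hg : g.support.Finite) :
    ∫ v : Fin r → Fin d → ℝ, g (floorV v) = ∑ᶠ m, g m := by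
  classical
  rw [finsum_eq_sum_of_support_subset g (s := hg.toFinset) (by simp)]
  have h1 : ∀ v : Fin r → Fin d → ℝ, g (floorV v) =
      ∑ m ∈ hg.toFinset, (floorV ⁻¹' {m}).indicator (fun _ => g m) v := by
    intro v
    simp only [Set.indicator_apply, Set.mem_preimage, Set.mem_singleton_iff]
    rw [Finset.sum_ite_eq]
    simp only [Set.Finite.mem_toFinset, Function.mem_support]
    split_ifs with h
    · rfl
    · simpa using h
  simp_rw [h1]
  have hm : ∀ m, MeasurableSet (floorV ⁻¹' {m} : Set (Fin r → Fin d → ℝ)) :=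
    fun m => measurable_floorV (MeasurableSet.singleton m)
  rw [integral_finsetSum]
  · refine Finset.sum_congr rfl fun m _ => ?_
    rw [integral_indicator_const _ (hm m), Measure.real, volume_cube]
    simp
  · intro m _
    refine (integrable_indicator_iff (hm m)).2 (integrableOn_const ?_)
    rw [volume_cube]; simp

lemma norm_floor_sub {r d : ℕ} (ε : ℝ) (hε : 0 < ε) (x : Fin r → Fin d → ℝ) :
    ‖ε • castV (floorV (ε⁻¹ • x)) - x‖ ≤ ε := by
  refine (pi_norm_le_iff_of_nonneg hε.le).2 fun i => (pi_norm_le_iff_of_nonneg hε.le).2 fun j => ?_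
  simp only [castV, floorV, Pi.sub_apply, Pi.smul_apply, smul_eq_mul, Real.norm_eq_abs]
  have h1 := Int.floor_le (ε⁻¹ * x i j)
  have h2 := Int.lt_floor_add_one (ε⁻¹ * x i j)
  have h3 : x i j = ε * (ε⁻¹ * x i j) := by field_simp
  rw [abs_le]
  constructor <;> nlinarith

lemma finite_supp {r d : ℕ} (F : (Fin r → Fin d → ℝ) → ℝ) (R : ℝ)
    (hR : ∀ v, F v ≠ 0 → ‖v‖ ≤ R) (ε : ℝ) (hε : 0 < ε) :
    (Function.support fun m : Fin r → Fin d → ℤ => F (ε • castV m)).Finite := by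
  refine (Set.finite_Icc (fun _ _ => ⌊-(R / ε)⌋ : Fin r → Fin d → ℤ)
    (fun _ _ => ⌈R / ε⌉)).subset ?_
  intro m hm
  have h1 := hR _ hm
  have h2 : ∀ i j, |(m i j : ℝ)| ≤ R / ε := by
    intro i j
    have := (norm_le_pi_norm ((ε • castV m) i) j).trans ((norm_le_pi_norm (ε • castV m) i).trans h1)
    simp only [castV, Pi.smul_apply, smul_eq_mul, Real.norm_eq_abs, abs_mul, abs_of_pos hε] at this
    rw [le_div_iff₀ hε]; linarith
  constructor
  · intro i j
    have := (Int.floor_le (-(R / ε))).trans (abs_le.1 (h2 i j)).1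
    exact_mod_cast this
  · intro i j
    have := (abs_le.1 (h2 i j)).2.trans (Int.le_ceil (R / ε))
    exact_mod_cast this

lemma riemann_key {r d : ℕ} (F : (Fin r → Fin d → ℝ) → ℝ) (R C : ℝ)
    (hR : ∀ v, F v ≠ 0 → ‖v‖ ≤ R) (hC : ∀ v, |F v| ≤ C) 
    (hc : ∀ᵐ v, ContinuousAt F v) :
    Tendsto (fun ε : ℝ => ε ^ (r * d) * ∑ᶠ m : Fin r → Fin d → ℤ, F (ε • castV m))
      (𝓝[>] 0) (𝓝 (∫ v, F v)) := by
  have h1 : ∀ᶠ ε : ℝ in 𝓝[>] 0, ∫ x, F (ε • castV (floorV (ε⁻¹ • x))) =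
      ε ^ (r * d) * ∑ᶠ m : Fin r → Fin d → ℤ, F (ε • castV m) := by
    filter_upwards [self_mem_nhdsWithin] with ε hε
    have hε : 0 < ε := hε
    rw [← integral_floor _ (finite_supp F R hR ε hε)]
    have := Measure.integral_comp_smul (volume : Measure (Fin r → Fin d → ℝ))
      (fun y => F (ε • castV (floorV y))) ε⁻¹
    rw [this]
    simp [Module.finrank_pi_fintype, abs_of_pos hε]
  refine Tendsto.congr' h1 ?_
  refine tendsto_integral_filter_of_dominated_convergence
    ((Metric.closedBall (0 : Fin r → Fin d → ℝ) (R + 1)).indicator fun _ => C) ?_ ?_ ?_ ?_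
  · refine Eventually.of_forall fun ε => Measurable.aestronglyMeasurable ?_
    exact (measurable_of_countable (fun m : Fin r → Fin d → ℤ => F (ε • castV m))).comp
      (measurable_floorV.comp (measurable_const_smul ε⁻¹))
  · have : ∀ᶠ ε : ℝ in 𝓝[>] 0, ε < 1 := mem_nhdsWithin_of_mem_nhds (Iio_mem_nhds one_pos)
    filter_upwards [self_mem_nhdsWithin, this] with ε hε hε1
    refine Eventually.of_forall fun x => ?_
    by_cases hx : F (ε • castV (floorV (ε⁻¹ • x))) = 0
    · rw [hx]
      simp only [norm_zero]
      exact Set.indicator_nonneg (fun _ _ => (abs_nonneg _).trans (hC 0)) _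
    · rw [Set.indicator_of_mem]
      · exact hC _
      · have h2 := hR _ hx
        have h3 := norm_floor_sub ε hε x
        rw [mem_closedBall_zero_iff]
        have := norm_sub_norm_le x (ε • castV (floorV (ε⁻¹ • x)))
        rw [norm_sub_rev] at this
        linarith
  · refine (integrable_indicator_iff Metric.isClosed_closedBall.measurableSet).2
      (integrableOn_const ?_)
    exact measure_closedBall_lt_top.ne
  · filter_upwards [hc] with x hx
    refine hx.tendsto.comp ?_
    rw [tendsto_iff_norm_sub_tendsto_zero]
    refine squeeze_zero' (Eventually.of_forall fun _ => norm_nonneg _) ?_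
      (tendsto_id.mono_left nhdsWithin_le_nhds)
    filter_upwards [self_mem_nhdsWithin] with ε hε
    exact norm_floor_sub ε hε x

open scoped Pointwise in
lemma level_null {E : Type*} [NormedAddCommGroup E] [NormedSpace ℝ E] [FiniteDimensional ℝ E]
    [MeasurableSpace E] [BorelSpace E] (μ : Measure E) [μ.IsAddHaarMeasure] (h : E → ℝ)
    (hc : Continuous h) (k : ℕ) (hk : k ≠ 0) (hh : ∀ t : ℝ, 0 < t → ∀ v, h (t • v) = t ^ k * h v) :
    μ {v | h v = 1} = 0 := by
  by_contra hne
  have hcount := Measure.countable_meas_level_set_pos (μ := μ) hc.measurable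
  have hsub : Set.Ioo (0 : ℝ) 1 ⊆ {t : ℝ | 0 < μ {a | h a = t}} := by
    intro t ht
    have ht : 0 < t := ht.1
    have hs : 0 < t ^ ((k : ℝ)⁻¹) := Real.rpow_pos_of_pos ht _
    have hsk : (t ^ ((k : ℝ)⁻¹)) ^ k = t := Real.rpow_inv_natCast_pow ht.le hk
    have : {a | h a = t} = (t ^ ((k : ℝ)⁻¹)) • {v | h v = 1} := by
      ext a
      rw [Set.mem_smul_set_iff_inv_smul_mem₀ hs.ne']
      simp only [Set.mem_ofPred_eq]
      rw [hh _ (inv_pos.2 hs), inv_pow, hsk, inv_mul_eq_one₀ ht.ne', eq_comm]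
    simp only [Set.mem_ofPred_eq]
    rw [this, Measure.addHaar_smul]
    refine pos_iff_ne_zero.2 (mul_ne_zero ?_ hne)
    simp [hs.ne']
  exact absurd (Cardinal.Real.Ioo_countable_iff.1 (hcount.mono hsub)) (by norm_num)

/-- Riemann-summation equidistribution: for a degree-zero homogeneous function `f`
supported (conically) in the positive-definite cone `Ω` and with compact support
in the level set `Ω₁ = {h = 1}` of the Gram determinant `h`, the normalized sums
of `f` over integer tuples with Gram determinant at most `n` converge to the
integral of `f` over `Ω_{≤1}` with respect to Lebesgue measure (normalized so
that the lattice `(ℤ^d)^r` has covolume 1). -/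
theorem lattice_sum_tendsto_integral
    (d r : ℕ) (hd : 1 ≤ d) (hr : 1 ≤ r)
    (B : (Fin d → ℝ) →ₗ[ℝ] (Fin d → ℝ) →ₗ[ℝ] ℝ)
    (hBsymm : ∀ x y, B x y = B y x)
    (h : (Fin r → Fin d → ℝ) → ℝ)
    (hh : ∀ v, h v = (Matrix.of fun i j => B (v i) (v j)).det)
    (Ω Ω1 Ωle : Set (Fin r → Fin d → ℝ))
    (hΩ : Ω = {v | (Matrix.of fun i j => B (v i) (v j)).PosDef})
    (hΩ1 : Ω1 = {v ∈ Ω | h v = 1})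
    (hΩle : Ωle = {v ∈ Ω | h v ≤ 1})
    (f : (Fin r → Fin d → ℝ) → ℝ)
    (hf_cont : ∀ v ≠ 0, ContinuousAt f v)
    (hf_supp : ∀ v ∉ Ω, f v = 0)
    (hf_hom : ∀ t : ℝ, 0 < t → ∀ v ∈ Ω, f (t • v) = f v)
    (hf_cpt : IsCompact (closure {v ∈ Ω1 | f v ≠ 0}) ∧
      closure {v ∈ Ω1 | f v ≠ 0} ⊆ Ω1) :
    Tendsto (fun n : ℕ =>
        (n : ℝ) ^ (-(d : ℝ) / 2) *
          ∑ᶠ v ∈ {v : Fin r → Fin d → ℝ |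
            (∀ i j, ∃ m : ℤ, v i j = (m : ℝ)) ∧ v ∈ Ω ∧ h v ≤ (n : ℝ)}, f v)
      atTop (𝓝 (∫ v in Ωle, f v)) := by
  have hmat : ∀ (t : ℝ) (v : Fin r → Fin d → ℝ),
      (Matrix.of fun i j => B ((t • v) i) ((t • v) j)) =
        (t ^ 2) • (Matrix.of fun i j => B (v i) (v j)) := by
    intro t v
    ext i j
    simp [Matrix.smul_apply]
    ring
  have hhom : ∀ (t : ℝ) (v : Fin r → Fin d → ℝ), h (t • v) = t ^ (2 * r) * h v := by
    intro t v
    rw [hh, hh, hmat, Matrix.det_smul, Fintype.card_fin, pow_mul]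
  have hΩsmul : ∀ (t : ℝ), 0 < t → ∀ v ∈ Ω, t • v ∈ Ω := by
    intro t ht v hv
    subst hΩ
    change Matrix.PosDef _
    rw [hmat]
    exact Matrix.PosDef.smul hv (by positivity)
  have hpos : ∀ v ∈ Ω, 0 < h v := by
    intro v hv
    subst hΩ
    rw [hh]
    exact Matrix.PosDef.det_pos hv
  have h2r : 2 * r ≠ 0 := by omega
  have h0 : (0 : Fin r → Fin d → ℝ) ∉ Ω := by
    intro h0
    have h1 := hpos _ h0
    have h2 := hhom 0 0
    rw [zero_pow h2r, zero_mul, smul_zero] at h2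
    linarith
  have hfsmul : ∀ (t : ℝ), 0 < t → ∀ v, f (t • v) = f v := by
    intro t ht v
    by_cases hv : v ∈ Ω
    · exact hf_hom t ht v hv
    · rw [hf_supp v hv, hf_supp]
      intro h'
      apply hv
      have := hΩsmul t⁻¹ (inv_pos.2 ht) _ h'
      rwa [inv_smul_smul₀ ht.ne'] at this
  have hcont : Continuous h := by
    have : h = fun v => (Matrix.of fun i j => B (v i) (v j)).det := funext hh
    rw [this]
    refine Continuous.matrix_det (continuous_matrix fun i j => ?_)
    simp only [Matrix.of_apply]
    have hB : Continuous fun p : (Fin d → ℝ) × (Fin d → ℝ) => B p.1 p.2 := by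
      have : (fun p : (Fin d → ℝ) × (Fin d → ℝ) => B p.1 p.2) =
          fun p => ∑ a, ∑ b, p.1 a * p.2 b * B (Pi.single a 1) (Pi.single b 1) := by
        funext p
        conv_lhs => rw [pi_eq_sum_univ' p.1, pi_eq_sum_univ' p.2]
        simp only [map_sum, LinearMap.sum_apply, map_smul, LinearMap.smul_apply, smul_eq_mul]
        rw [Finset.sum_comm]
        refine Finset.sum_congr rfl fun a _ => ?_
        simp only [Finset.mul_sum]
        refine Finset.sum_congr rfl fun b _ => ?_
        ring
      rw [this]
      fun_prop
    exact hB.comp (by fun_prop : Continuous fun v : Fin r → Fin d → ℝ => (v i, v j))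
  set K := closure {v ∈ Ω1 | f v ≠ 0} with hK
  obtain ⟨hKc, hKs⟩ := hf_cpt
  have hKΩ : ∀ v ∈ K, v ∈ Ω := by
    intro v hv
    have := hKs hv
    rw [hΩ1] at this
    exact this.1
  obtain ⟨R, hR⟩ := hKc.isBounded.exists_norm_le
  obtain ⟨C, hC⟩ := hKc.exists_bound_of_continuousOn (f := f) (fun v hv =>
    (hf_cont v (fun h' => h0 (h' ▸ hKΩ v hv))).continuousWithinAt)
  set F : (Fin r → Fin d → ℝ) → ℝ := {v | h v ≤ 1}.indicator f with hF
  have hFK : ∀ v, F v ≠ 0 → ∃ t : ℝ, 1 ≤ t ∧ t • v ∈ K := by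
    intro v hv
    have hv1 : h v ≤ 1 := by
      by_contra hcon
      exact hv (Set.indicator_of_notMem (by simpa using hcon) _)
    have hv2 : f v ≠ 0 := by
      rwa [hF, Set.indicator_of_mem (by simpa using hv1)] at hv
    have hvΩ : v ∈ Ω := by
      by_contra hcon
      exact hv2 (hf_supp v hcon)
    have hp := hpos v hvΩ
    have hs : 0 < (h v) ⁻¹ ^ (((2 * r : ℕ) : ℝ)⁻¹) := Real.rpow_pos_of_pos (inv_pos.2 hp) _
    have hsk : ((h v) ⁻¹ ^ (((2 * r : ℕ) : ℝ)⁻¹)) ^ (2 * r) = (h v)⁻¹ :=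
      Real.rpow_inv_natCast_pow (inv_pos.2 hp).le h2r
    refine ⟨_, Real.one_le_rpow ((one_le_inv₀ hp).2 hv1)
      (inv_nonneg.2 (Nat.cast_nonneg (2 * r))), subset_closure ⟨?_, ?_⟩⟩
    · rw [hΩ1]
      refine ⟨hΩsmul _ hs v hvΩ, ?_⟩
      rw [hhom, hsk, inv_mul_cancel₀ hp.ne']
    · rwa [hfsmul _ hs]
  have hFR : ∀ v, F v ≠ 0 → ‖v‖ ≤ R := by
    intro v hv
    obtain ⟨t, ht, hk⟩ := hFK v hv
    have := hR _ hk
    rw [norm_smul, Real.norm_eq_abs, abs_of_pos (by linarith)] at this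
    nlinarith [norm_nonneg v]
  have hFC : ∀ v, |F v| ≤ max C 0 := by
    intro v
    by_cases hv : F v = 0
    · simp [hv]
    · obtain ⟨t, ht, hk⟩ := hFK v hv
      have h1 := hC _ hk
      rw [hfsmul t (by linarith)] at h1
      refine le_trans ?_ (h1.trans (le_max_left _ _))
      exact norm_indicator_le_norm_self f v
  have hFc : ∀ᵐ v, ContinuousAt F v := by
    have hnull := level_null (volume : Measure (Fin r → Fin d → ℝ)) h hcont (2 * r) h2r
      (fun t _ v => hhom t v)
    have hae : ∀ᵐ v : Fin r → Fin d → ℝ, h v ≠ 1 := by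
      rw [ae_iff]
      simpa using hnull
    have hz : ∀ v : Fin r → Fin d → ℝ, f v ≠ 0 → v ≠ 0 := by
      rintro v hv rfl
      exact hv (hf_supp 0 h0)
    have : Nonempty (Fin r) := ⟨⟨0, hr⟩⟩
    have : Nonempty (Fin d) := ⟨⟨0, hd⟩⟩
    have hae0 : ∀ᵐ v : Fin r → Fin d → ℝ, v ≠ 0 := by
      rw [ae_iff]
      simp
    filter_upwards [hae, hae0] with v hv hv0
    rcases lt_or_gt_of_ne hv with hlt | hgt
    · refine (hf_cont v hv0).congr ?_
      filter_upwards [hcont.continuousAt.eventually_lt_const hlt] with w hw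
      exact (Set.indicator_of_mem (by simpa using hw.le) _).symm
    · refine (continuousAt_const (y := (0 : ℝ))).congr ?_
      filter_upwards [hcont.continuousAt.eventually_const_lt hgt] with w hw
      exact (Set.indicator_of_notMem (by simpa using hw) _).symm
  have key := riemann_key F R (max C 0) hFR hFC hFc
  have hIntEq : ∫ v in Ωle, f v = ∫ v, F v := by
    have hms : MeasurableSet {v | h v ≤ 1} := (isClosed_le hcont continuous_const).measurableSet
    rw [hF, integral_indicator hms]
    symm
    refine setIntegral_eq_of_subset_of_forall_sdiff_eq_zero hms ?_ ?_
    · rw [hΩle]; exact fun v hv => hv.2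
    · intro v hv
      apply hf_supp
      intro hcon
      apply hv.2
      rw [hΩle]
      exact ⟨hcon, hv.1⟩
  rw [hIntEq]
  have hε : Tendsto (fun n : ℕ => (n : ℝ) ^ (-(((2 * r : ℕ) : ℝ)⁻¹))) atTop (𝓝[>] 0) := by
    rw [tendsto_nhdsWithin_iff]
    constructor
    · refine (tendsto_rpow_neg_atTop ?_).comp tendsto_natCast_atTop_atTop
      exact inv_pos.2 (Nat.cast_pos.2 (Nat.pos_of_ne_zero h2r))
    · filter_upwards [eventually_gt_atTop 0] with n hn
      exact Real.rpow_pos_of_pos (Nat.cast_pos.2 hn) _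
  refine (key.comp hε).congr' ?_
  filter_upwards [eventually_gt_atTop 0] with n hn
  have hn' : (0 : ℝ) < n := Nat.cast_pos.2 hn
  simp only [Function.comp]
  set ε := (n : ℝ) ^ (-(((2 * r : ℕ) : ℝ)⁻¹)) with hεdef
  have hεpos : 0 < ε := Real.rpow_pos_of_pos hn' _
  have hr0 : (r : ℝ) ≠ 0 := Nat.cast_ne_zero.2 (by omega)
  have hεr : ε ^ (2 * r) = (n : ℝ)⁻¹ := by
    rw [hεdef, Real.rpow_neg hn'.le, inv_pow, Real.rpow_inv_natCast_pow hn'.le h2r]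
  have hεd : ε ^ (r * d) = (n : ℝ) ^ (-(d : ℝ) / 2) := by
    rw [hεdef, ← Real.rpow_natCast, ← Real.rpow_mul hn'.le]
    congr 1
    push_cast
    field_simp
  rw [hεd]
  congr 1
  have hinj : Function.Injective (castV : (Fin r → Fin d → ℤ) → _) := by
    intro a b hab
    ext i j
    have := congrFun (congrFun hab i) j
    simpa [castV] using this
  rw [← finsum_mem_range (f := fun v => F (ε • v)) hinj]
  refine finsum_congr fun v => ?_
  have hFv : F (ε • v) = if h v ≤ n then f v else 0 := by
    have : h (ε • v) ≤ 1 ↔ h v ≤ n := by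
      rw [hhom, hεr, inv_mul_le_iff₀ hn', mul_one]
    simp only [hF, Set.indicator_apply, Set.mem_ofPred_eq, this, hfsmul ε hεpos]
  have hrange : v ∈ Set.range (castV : (Fin r → Fin d → ℤ) → _) ↔
      ∀ i j, ∃ m : ℤ, v i j = (m : ℝ) := by
    constructor
    · rintro ⟨m, rfl⟩ i j
      exact ⟨m i j, rfl⟩
    · intro hm
      choose m hm using hm
      exact ⟨m, by ext i j; exact (hm i j).symm⟩
  simp only [hrange, hFv, Set.mem_ofPred_eq]
  by_cases h1 : ∀ i j, ∃ m : ℤ, v i j = (m : ℝ)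
  · by_cases h2 : v ∈ Ω
    · by_cases h3 : h v ≤ n <;> simp [h1, h2, h3]
    · simp [h2, hf_supp v h2]
  · simp [h1]
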